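/- Let N ≥ 2, let {e_i}_{i=1}^N be the canonical orthonormal basis of ℝ^N, and define φ_1 = e_1, φ_2 = e_2, φ_3 = (e_1 − e_2)/√2. Then the three hyperplanes {φ_i^⊥}_{i=1}^3 do norm retrieval in ℝ^N. In particular, in ℝ^N three proper subspaces of codimension one can do norm retrieval. -/

import Mathlib

open Submodule
open scoped RealInnerProductSpace

lemma norm_sq_orthogonalProjectionOnto_orthogonal_span_singleton {E : Type*}
    [NormedAddCommGroup E] [InnerProductSpace ℝ E] {v : E} (hv : ‖v‖ = 1) (x : E) :
    ‖orthogonalProjectionOnto (ℝ ∙ v)ᗮ x‖ ^ 2 = ‖x‖ ^ 2 - ⟪v, x⟫ ^ 2 := by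
  have h := Submodule.norm_sq_eq_add_norm_sq_projection x (ℝ ∙ v)
  have hp : ‖orthogonalProjectionOnto (ℝ ∙ v) x‖ = |⟪v, x⟫| := by
    rw [← Submodule.norm_coe, ← Submodule.starProjection_apply,
      Submodule.starProjection_unit_singleton ℝ hv, norm_smul, hv, mul_one, Real.norm_eq_abs]
  rw [hp, sq_abs] at h
  linarith

/-- If `a² - c²`, `b² - d²` and `((a - b)² - (c - d)²) / 2` all equal `t`, then `t ≤ 0`. -/
lemma nonpos_of_sq_sub_sq_eq {a b c d t : ℝ} (ha : a ^ 2 - c ^ 2 = t) (hb : b ^ 2 - d ^ 2 = t)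
    (hab : (a - b) ^ 2 / 2 - (c - d) ^ 2 / 2 = t) : t ≤ 0 := by
  by_contra! ht
  have hmul : a * b = c * d := by linarith
  have hsq : a ^ 2 * b ^ 2 = c ^ 2 * d ^ 2 := by rw [← mul_pow, ← mul_pow, hmul]
  have ha' : a ^ 2 = c ^ 2 + t := by linarith
  have hb' : b ^ 2 = d ^ 2 + t := by linarith
  rw [ha', hb'] at hsq
  nlinarith [mul_pos ht ht, mul_nonneg (sq_nonneg c) ht.le, mul_nonneg (sq_nonneg d) ht.le]

/-- In `ℝ^N` (`N ≥ 2`), the three hyperplanes `e₁ᗮ`, `e₂ᗮ`, `((e₁ - e₂)/√2)ᗮ`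
do norm retrieval. -/
theorem stmt_3 (N : ℕ) (hN : 2 ≤ N)
    (φ : Fin 3 → EuclideanSpace ℝ (Fin N))
    (hφ : φ = ![EuclideanSpace.single ⟨0, by omega⟩ (1 : ℝ),
      EuclideanSpace.single ⟨1, by omega⟩ (1 : ℝ),
      (Real.sqrt 2)⁻¹ •
        (EuclideanSpace.single ⟨0, by omega⟩ (1 : ℝ) - EuclideanSpace.single ⟨1, by omega⟩ (1 : ℝ))]) :
    ∀ x y : EuclideanSpace ℝ (Fin N),
      (∀ i, ‖orthogonalProjection (ℝ ∙ φ i)ᗮ x‖ = ‖orthogonalProjection (ℝ ∙ φ i)ᗮ y‖) →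
      ‖x‖ = ‖y‖ := by
  intro x y h
  set u : EuclideanSpace ℝ (Fin N) := EuclideanSpace.single ⟨0, by omega⟩ (1 : ℝ) with hu
  set v : EuclideanSpace ℝ (Fin N) := EuclideanSpace.single ⟨1, by omega⟩ (1 : ℝ) with hv
  have hu1 : ‖u‖ = 1 := by simp [hu]
  have hv1 : ‖v‖ = 1 := by simp [hv]
  have huv : ⟪u, v⟫ = 0 := by simp [hu, hv, EuclideanSpace.inner_single_left]
  have hs : (Real.sqrt 2)⁻¹ ^ 2 = 1 / 2 := by
    rw [inv_pow, Real.sq_sqrt (by norm_num)]; norm_num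
  have hw1 : ‖(Real.sqrt 2)⁻¹ • (u - v)‖ = 1 := by
    rw [← sq_eq_sq₀ (norm_nonneg _) zero_le_one, norm_smul, mul_pow, Real.norm_eq_abs, sq_abs, hs,
      norm_sub_sq_real, hu1, hv1, huv]
    norm_num
  have key : ∀ i, ‖φ i‖ = 1 → ⟪φ i, x⟫ ^ 2 - ⟪φ i, y⟫ ^ 2 = ‖x‖ ^ 2 - ‖y‖ ^ 2 := by
    intro i hi
    have hx := norm_sq_orthogonalProjectionOnto_orthogonal_span_singleton hi x
    have hy := norm_sq_orthogonalProjectionOnto_orthogonal_span_singleton hi y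
    have hxy : ‖orthogonalProjectionOnto (ℝ ∙ φ i)ᗮ x‖ = ‖orthogonalProjectionOnto (ℝ ∙ φ i)ᗮ y‖ :=
      h i
    rw [hxy] at hx
    linarith
  subst hφ
  have h0 : ⟪u, x⟫ ^ 2 - ⟪u, y⟫ ^ 2 = ‖x‖ ^ 2 - ‖y‖ ^ 2 := key 0 hu1
  have h1 : ⟪v, x⟫ ^ 2 - ⟪v, y⟫ ^ 2 = ‖x‖ ^ 2 - ‖y‖ ^ 2 := key 1 hv1
  have h2 : ⟪(Real.sqrt 2)⁻¹ • (u - v), x⟫ ^ 2 - ⟪(Real.sqrt 2)⁻¹ • (u - v), y⟫ ^ 2 =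
      ‖x‖ ^ 2 - ‖y‖ ^ 2 := key 2 hw1
  rw [real_inner_smul_left, real_inner_smul_left, mul_pow, mul_pow, hs, inner_sub_left,
    inner_sub_left] at h2
  have hle : ‖x‖ ^ 2 - ‖y‖ ^ 2 ≤ 0 := nonpos_of_sq_sub_sq_eq h0 h1 (by linarith)
  have hge : ‖y‖ ^ 2 - ‖x‖ ^ 2 ≤ 0 :=
    nonpos_of_sq_sub_sq_eq (a := ⟪u, y⟫) (b := ⟪v, y⟫) (c := ⟪u, x⟫) (d := ⟪v, x⟫)
      (by linarith) (by linarith) (by linarith)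
  rw [← sq_eq_sq₀ (norm_nonneg x) (norm_nonneg y)]
  linarith
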